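/- Let Γ be a countable group of affine transformations of ℝⁿ, let W ⊆ ℝⁿ be an open set (not necessarily connected), and let h : W → ℝⁿ be a C¹ map preserving Γ-orbits (h(x) ∈ Γ·x for all x ∈ W). Then for each x ∈ W there exist γ ∈ Γ and an open neighbourhood U of x contained in W such that h agrees with the affine map γ on U. -/

import Mathlib

open Set Filter Topology

section OrbitRigidity

/-- The set of points at which `h` and `g` have the same germ. -/
def germSet {X Y : Type*} [TopologicalSpace X] (h g : X → Y) : Set X := {x | h =ᶠ[𝓝 x] g}

theorem isOpen_germSet {X Y : Type*} [TopologicalSpace X] (h g : X → Y) :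
    IsOpen (germSet h g) :=
  isOpen_setOfPred_eventually_nhds

variable {E : Type*} [NormedAddCommGroup E] [NormedSpace ℝ E]

/-- The set of points at which `h` has the same germ as some element of `Γ`. -/
def locallyIn (Γ : Subgroup (E ≃ᵃ[ℝ] E)) (h : E → E) : Set E :=
  {x | ∃ γ ∈ Γ, x ∈ germSet h γ}

theorem isOpen_locallyIn (Γ : Subgroup (E ≃ᵃ[ℝ] E)) (h : E → E) : IsOpen (locallyIn Γ h) := by
  have : locallyIn Γ h = ⋃ γ ∈ Γ, germSet h γ := by
    ext x
    simp [locallyIn]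
  rw [this]
  exact isOpen_biUnion fun γ _ => isOpen_germSet h γ

/-- If the derivative of `f` in direction `u` is positive at `p`, then `f` is strictly increasing
along short segments in direction `u` near `p`. -/
theorem exists_strictMonoOn_segment {W : Set E} (hW : IsOpen W) {f : E → ℝ}
    (hf : ContDiffOn ℝ 1 f W) {p u : E} (hp : p ∈ W) (hu : 0 < fderiv ℝ f p u) :
    ∃ δ > 0, ∃ ε > 0, ∀ x ∈ Metric.ball p ε,
      (∀ t ∈ Icc (0 : ℝ) δ, x + t • u ∈ W) ∧
        StrictMonoOn (fun t : ℝ => f (x + t • u)) (Icc 0 δ) := by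
  have hcont : ContinuousAt (fun y => fderiv ℝ f y u) p :=
    (((hf.continuousOn_fderiv_of_isOpen hW le_rfl).continuousAt (hW.mem_nhds hp))).clm_apply
      continuousAt_const
  obtain ⟨r, hr, hball⟩ := Metric.mem_nhds_iff.1
    (inter_mem (hW.mem_nhds hp) (hcont.eventually (lt_mem_nhds hu)))
  have hmaps : ∃ δ > 0, ∃ ε > 0, ∀ x ∈ Metric.ball p ε, ∀ t ∈ Icc (0 : ℝ) δ,
      x + t • u ∈ Metric.ball p r := by
    refine ⟨r / 2 / (‖u‖ + 1), by positivity, r / 2, by positivity, fun x hx t ht => ?_⟩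
    rw [mem_ball_iff_norm] at hx ⊢
    have h1 : ‖t • u‖ ≤ r / 2 := by
      rw [norm_smul, Real.norm_of_nonneg ht.1]
      calc t * ‖u‖ ≤ r / 2 / (‖u‖ + 1) * (‖u‖ + 1) := by
            gcongr
            · exact ht.2
            · linarith
        _ = r / 2 := by field_simp
    calc ‖x + t • u - p‖ = ‖(x - p) + t • u‖ := by congr 1; abel
      _ ≤ ‖x - p‖ + ‖t • u‖ := norm_add_le _ _
      _ < r := by linarith
  obtain ⟨δ, hδ, ε, hε, hδε⟩ := hmaps
  refine ⟨δ, hδ, ε, hε, fun x hx => ⟨fun t ht => (hball (hδε x hx t ht)).1, ?_⟩⟩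
  have hderiv : ∀ t ∈ Icc (0 : ℝ) δ,
      HasDerivAt (fun t : ℝ => f (x + t • u)) (fderiv ℝ f (x + t • u) u) t := by
    intro t ht
    have hd : HasFDerivAt f (fderiv ℝ f (x + t • u)) (x + t • u) :=
      ((hf.differentiableOn one_ne_zero).differentiableAt
        (hW.mem_nhds (hball (hδε x hx t ht)).1)).hasFDerivAt
    have hl : HasDerivAt (fun t : ℝ => x + t • u) u t := by
      simpa using ((hasDerivAt_id t).smul_const u).const_add x
    exact hd.comp_hasDerivAt t hl
  refine strictMonoOn_of_deriv_pos (convex_Icc 0 δ)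
    (fun t ht => (hderiv t ht).continuousAt.continuousWithinAt) fun t ht => ?_
  have ht' := interior_subset ht
  rw [(hderiv t ht').deriv]
  exact (hball (hδε x hx t ht')).2

variable [FiniteDimensional ℝ E]

theorem AffineEquiv.hasFDerivAt_toContinuousLinearMap (g : E ≃ᵃ[ℝ] E) (x : E) :
    HasFDerivAt g (LinearMap.toContinuousLinearMap (g.linear : E →ₗ[ℝ] E)) x := by
  have hg : (g : E → E) =
      fun y => LinearMap.toContinuousLinearMap (g.linear : E →ₗ[ℝ] E) y + g 0 := by
    funext y
    simpa using g.map_vadd 0 y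
  rw [hg]
  exact (ContinuousLinearMap.hasFDerivAt _).add_const _

theorem AffineEquiv.eq_of_fderiv_eq {g g' : E ≃ᵃ[ℝ] E} {p : E} (hp : g p = g' p)
    (hd : fderiv ℝ g p = fderiv ℝ g' p) : g = g' := by
  rw [(g.hasFDerivAt_toContinuousLinearMap p).fderiv,
    (g'.hasFDerivAt_toContinuousLinearMap p).fderiv] at hd
  ext y
  have h1 := g.map_vadd p (y - p)
  have h2 := g'.map_vadd p (y - p)
  have h3 := DFunLike.congr_fun hd (y - p)
  simp only [LinearMap.coe_toContinuousLinearMap', LinearEquiv.coe_coe] at h3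
  simp only [vadd_eq_add, sub_add_cancel] at h1 h2
  rw [h1, h2, h3, hp]

theorem AffineEquiv.fderiv_eq_fderiv (g : E ≃ᵃ[ℝ] E) (x y : E) :
    fderiv ℝ g x = fderiv ℝ g y := by
  rw [(g.hasFDerivAt_toContinuousLinearMap x).fderiv,
    (g.hasFDerivAt_toContinuousLinearMap y).fderiv]

theorem AffineEquiv.eq_of_mem_germSet {h : E → E} {g g' : E ≃ᵃ[ℝ] E} {p : E}
    (hg : p ∈ germSet h g) (hg' : p ∈ germSet h g') : g = g' := by
  have : (g : E → E) =ᶠ[𝓝 p] g' := (EventuallyEq.symm hg).trans hg'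
  exact eq_of_fderiv_eq this.eq_of_nhds this.fderiv_eq

/-- A `C¹` map has the same 1-jet as the affine map `g` at every point in the closure of the set
where it has the same germ as `g`. -/
theorem jet_eq_of_mem_closure_germSet {W : Set E} (hW : IsOpen W) {h : E → E}
    (hh : ContDiffOn ℝ 1 h W) {g : E ≃ᵃ[ℝ] E} {p : E} (hp : p ∈ W)
    (hcl : p ∈ closure (germSet h g)) : h p = g p ∧ fderiv ℝ h p = fderiv ℝ g p := by
  have := mem_closure_iff_nhdsWithin_neBot.1 hcl
  have hpW := hW.mem_nhds hp
  constructor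
  · have h1 : Tendsto h (𝓝[germSet h g] p) (𝓝 (h p)) :=
      (hh.continuousOn.continuousAt hpW).mono_left inf_le_left
    have h2 : Tendsto g (𝓝[germSet h g] p) (𝓝 (g p)) :=
      (g.hasFDerivAt_toContinuousLinearMap p).continuousAt.mono_left inf_le_left
    refine tendsto_nhds_unique (h1.congr' ?_) h2
    filter_upwards [self_mem_nhdsWithin] with y hy using EventuallyEq.eq_of_nhds hy
  · have h1 : Tendsto (fderiv ℝ h) (𝓝[germSet h g] p) (𝓝 (fderiv ℝ h p)) :=
      ((hh.continuousOn_fderiv_of_isOpen hW le_rfl).continuousAt hpW).mono_left inf_le_left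
    refine tendsto_nhds_unique (h1.congr' ?_) tendsto_const_nhds
    filter_upwards [self_mem_nhdsWithin] with y hy
    rw [EventuallyEq.fderiv_eq hy, g.fderiv_eq_fderiv y p]

theorem IsPreconnected.subset_germSet {Γ : Subgroup (E ≃ᵃ[ℝ] E)} {h : E → E} {S : Set E}
    (hS : IsPreconnected S) (hSV : S ⊆ locallyIn Γ h) {g : E ≃ᵃ[ℝ] E} {x : E} (hx : x ∈ S)
    (hg : x ∈ germSet h g) : S ⊆ germSet h g := by
  refine hS.subset_of_closure_inter_subset (isOpen_germSet h g) ⟨x, hx, hg⟩ ?_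
  rintro y ⟨hy, hyS⟩
  obtain ⟨g', -, hg'⟩ := hSV hyS
  obtain ⟨z, hz', hz⟩ := mem_closure_iff.1 hy _ (isOpen_germSet h g') hg'
  rwa [AffineEquiv.eq_of_mem_germSet hz hz']

/-- If `h` is locally in `Γ` off the zero set of `f`, and `p` is a regular zero of `f`, then `h`
is given by a single element of `Γ` on the nonnegative side of `f` near `p`. -/
theorem exists_mem_closure_germSet_of_nonneg {Γ : Subgroup (E ≃ᵃ[ℝ] E)} {h : E → E}
    {W : Set E} (hW : IsOpen W) {f : E → ℝ} (hf : ContDiffOn ℝ 1 f W)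
    (hV : ∀ x ∈ W, f x ≠ 0 → x ∈ locallyIn Γ h) {p u : E} (hp : p ∈ W) (hfp : f p = 0)
    (hu : 0 < fderiv ℝ f p u) :
    ∃ g ∈ Γ, ∀ᶠ x in 𝓝 p, 0 ≤ f x → x ∈ closure (germSet h g) := by
  obtain ⟨δ, hδ, ε, hε, hseg⟩ := exists_strictMonoOn_segment hW hf hp hu
  have h0 : (0 : ℝ) ∈ Icc 0 δ := ⟨le_rfl, hδ.le⟩
  have h1 : δ ∈ Icc 0 δ := ⟨hδ.le, le_rfl⟩
  have hpε : p ∈ Metric.ball p ε := Metric.mem_ball_self hε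
  have hqW : p + δ • u ∈ W := (hseg p hpε).1 δ h1
  have hq : 0 < f (p + δ • u) := by
    simpa [hfp] using (hseg p hpε).2 h0 h1 hδ
  obtain ⟨r, hr, hrball⟩ := Metric.mem_nhds_iff.1 (inter_mem (hW.mem_nhds hqW)
    ((hf.continuousOn.continuousAt (hW.mem_nhds hqW)).eventually (lt_mem_nhds hq)))
  have hballV : Metric.ball (p + δ • u) r ⊆ locallyIn Γ h := fun y hy =>
    hV y (hrball hy).1 (ne_of_gt (hrball hy).2)
  obtain ⟨g, hgΓ, hg⟩ := hballV (Metric.mem_ball_self hr)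
  have hballg := (convex_ball (p + δ • u) r).isPreconnected.subset_germSet hballV
    (Metric.mem_ball_self hr) hg
  refine ⟨g, hgΓ, ?_⟩
  filter_upwards [Metric.ball_mem_nhds p hε, Metric.ball_mem_nhds p hr] with x hxε hxr hfx
  have hline : Continuous fun t : ℝ => x + t • u := by fun_prop
  have hsub : (fun t : ℝ => x + t • u) '' Ioc 0 δ ⊆ germSet h g := by
    refine (isPreconnected_Ioc.image _ hline.continuousOn).subset_germSet (Γ := Γ) ?_
      (mem_image_of_mem _ (right_mem_Ioc.2 hδ)) (hballg (by simpa using hxr))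
    rintro _ ⟨t, ht, rfl⟩
    have ht' : t ∈ Icc 0 δ := Ioc_subset_Icc_self ht
    have hlt := (hseg x hxε).2 h0 ht' ht.1
    simp only [zero_smul, add_zero] at hlt
    exact hV _ ((hseg x hxε).1 t ht') (ne_of_gt (hfx.trans_lt hlt))
  have h0cl : (0 : ℝ) ∈ closure (Ioc 0 δ) := by
    rwa [closure_Ioc hδ.ne]
  have := closure_mono hsub (image_closure_subset_closure_image hline ⟨0, h0cl, rfl⟩)
  simpa using this

/-- At a point near which `h` agrees with an affine map off `locallyIn Γ h`, but with a different
derivative, `h` is locally in `Γ`. -/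
theorem mem_locallyIn_of_fderiv_ne {Γ : Subgroup (E ≃ᵃ[ℝ] E)} {h : E → E}
    {W : Set E} (hW : IsOpen W) (hh : ContDiffOn ℝ 1 h W) {γ : E ≃ᵃ[ℝ] E}
    (hγ : ∀ x ∈ W, x ∉ locallyIn Γ h → h x = γ x) {p : E} (hp : p ∈ W)
    (hne : fderiv ℝ h p ≠ fderiv ℝ γ p) : p ∈ locallyIn Γ h := by
  by_contra hpV
  obtain ⟨u, hu⟩ : ∃ u, (fderiv ℝ h p - fderiv ℝ γ p) u ≠ 0 := by
    by_contra! hall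
    exact hne (sub_eq_zero.1 (ContinuousLinearMap.ext hall))
  obtain ⟨φ, hφ⟩ := SeparatingDual.exists_eq_one (R := ℝ) hu
  have hγsmooth : ContDiff ℝ 1 γ := by
    refine contDiff_one_iff_fderiv.2
      ⟨fun x => (γ.hasFDerivAt_toContinuousLinearMap x).differentiableAt, ?_⟩
    exact continuous_const.congr fun x => γ.fderiv_eq_fderiv p x
  set f : E → ℝ := fun x => φ (h x - γ x) with hf_def
  have hf : ContDiffOn ℝ 1 f W := φ.contDiff.comp_contDiffOn (hh.sub hγsmooth.contDiffOn)
  have hfd : HasFDerivAt f (φ.comp (fderiv ℝ h p - fderiv ℝ γ p)) p :=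
    φ.hasFDerivAt.comp p
      (((hh.differentiableOn one_ne_zero).differentiableAt (hW.mem_nhds hp)).hasFDerivAt.sub
        (γ.hasFDerivAt_toContinuousLinearMap p).differentiableAt.hasFDerivAt)
  have hfp : f p = 0 := by simp [hf_def, hγ p hp hpV]
  have hV : ∀ x ∈ W, f x ≠ 0 → x ∈ locallyIn Γ h := by
    intro x hx hfx
    by_contra hxV
    exact hfx (by simp [hf_def, hγ x hx hxV])
  obtain ⟨g, hgΓ, hg⟩ := exists_mem_closure_germSet_of_nonneg hW hf hV hp hfp (u := u) (by
    rw [hfd.fderiv, ContinuousLinearMap.comp_apply, hφ]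
    exact one_pos)
  obtain ⟨g', -, hg'⟩ := exists_mem_closure_germSet_of_nonneg (f := -f) hW hf.neg
    (fun x hx hfx => hV x hx (by simpa using hfx)) hp (by simpa using hfp) (u := -u) (by
      rw [hfd.neg.fderiv, neg_apply, map_neg, neg_neg,
        ContinuousLinearMap.comp_apply, hφ]
      exact one_pos)
  have hj := jet_eq_of_mem_closure_germSet hW hh hp (hg.self_of_nhds hfp.ge)
  have hj' := jet_eq_of_mem_closure_germSet hW hh hp (hg'.self_of_nhds (by simp [hfp]))
  obtain rfl : g = g' :=
    AffineEquiv.eq_of_fderiv_eq (hj.1.symm.trans hj'.1) (hj.2.symm.trans hj'.2)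
  refine hpV ⟨g, hgΓ, ?_⟩
  change h =ᶠ[𝓝 p] g
  filter_upwards [hg, hg', hW.mem_nhds hp] with x hx hx' hxW
  refine (jet_eq_of_mem_closure_germSet hW hh hxW ?_).1
  rcases le_total 0 (f x) with h0 | h0
  · exact hx h0
  · exact hx' (by simpa using h0)

/-- If `h` has the 1-jet of `γ` at each point of a convex open set off `locallyIn Γ h`, and there
is such a point, then `h = γ` on this set. -/
theorem eqOn_of_jet_eq {Γ : Subgroup (E ≃ᵃ[ℝ] E)} {h : E → E}
    {W : Set E} (hW : IsOpen W) (hconv : Convex ℝ W) (hh : ContDiffOn ℝ 1 h W) {γ : E ≃ᵃ[ℝ] E}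
    (hγ : ∀ x ∈ W, x ∉ locallyIn Γ h → h x = γ x ∧ fderiv ℝ h x = fderiv ℝ γ x)
    {p : E} (hp : p ∈ W) (hpV : p ∉ locallyIn Γ h) : EqOn h γ W := by
  intro x hx
  by_cases hxV : x ∈ locallyIn Γ h
  swap
  · exact (hγ x hx hxV).1
  have hline : Continuous fun t : ℝ => x + t • (p - x) := by fun_prop
  have hlineW : ∀ t ∈ Icc (0 : ℝ) 1, x + t • (p - x) ∈ W := fun t ht =>
    hconv.add_smul_sub_mem hx hp ht
  have hcomp : IsCompact (Icc (0 : ℝ) 1 ∩ (fun t : ℝ => x + t • (p - x)) ⁻¹' (locallyIn Γ h)ᶜ) :=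
    isCompact_Icc.inter_right ((isOpen_locallyIn Γ h).isClosed_compl.preimage hline)
  obtain ⟨t₀, ⟨ht₀, ht₀V⟩, hmin⟩ := hcomp.exists_isLeast ⟨1, by simp, by simpa using hpV⟩
  have ht₀pos : 0 < t₀ := by
    refine lt_of_le_of_ne ht₀.1 ?_
    rintro rfl
    exact ht₀V (by simpa using hxV)
  obtain ⟨g, -, hg⟩ := hxV
  have hsub : (fun t : ℝ => x + t • (p - x)) '' Ico 0 t₀ ⊆ germSet h g := by
    refine (isPreconnected_Ico.image _ hline.continuousOn).subset_germSet (Γ := Γ) ?_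
      (mem_image_of_mem _ (left_mem_Ico.2 ht₀pos)) (by simpa using hg)
    rintro _ ⟨t, ht, rfl⟩
    by_contra htV
    exact (hmin ⟨⟨ht.1, ht.2.le.trans ht₀.2⟩, htV⟩).not_gt ht.2
  have hcl : t₀ ∈ closure (Ico 0 t₀) := by
    rw [closure_Ico ht₀pos.ne]
    exact right_mem_Icc.2 ht₀pos.le
  have hj := jet_eq_of_mem_closure_germSet hW hh (hlineW t₀ ht₀)
    (closure_mono hsub (image_closure_subset_closure_image hline ⟨t₀, hcl, rfl⟩))
  have hj' := hγ _ (hlineW t₀ ht₀) ht₀V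
  obtain rfl : g = γ :=
    AffineEquiv.eq_of_fderiv_eq (hj.1.symm.trans hj'.1) (hj.2.symm.trans hj'.2)
  exact EventuallyEq.eq_of_nhds hg

/-- A `C¹` map preserving the orbits of a countable group `Γ` of affine transformations is locally
in `Γ`. -/
theorem subset_locallyIn_of_orbit {Γ : Subgroup (E ≃ᵃ[ℝ] E)} [Countable Γ] {h : E → E}
    {W : Set E} (hW : IsOpen W) (hh : ContDiffOn ℝ 1 h W)
    (horb : ∀ x ∈ W, ∃ γ ∈ Γ, h x = γ x) : W ⊆ locallyIn Γ h := by
  by_contra hcon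
  obtain ⟨x₀, hx₀⟩ : (W ∩ (locallyIn Γ h)ᶜ).Nonempty := inter_compl_nonempty_iff.2 hcon
  set K := W ∩ (locallyIn Γ h)ᶜ
  have : Nonempty K := ⟨⟨x₀, hx₀⟩⟩
  have : LocallyCompactSpace K :=
    (hW.isLocallyClosed.inter
      (isOpen_locallyIn Γ h).isClosed_compl.isLocallyClosed).locallyCompactSpace
  obtain ⟨γ, q, hq⟩ := nonempty_interior_of_iUnion_of_closed
    (f := fun γ : Γ => {x : K | h x = (γ : E ≃ᵃ[ℝ] E) x})
    (fun γ => isClosed_eq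
      ((hh.continuousOn.mono inter_subset_left).domRestrict)
      ((continuous_iff_continuousAt.2 fun x =>
        (AffineEquiv.hasFDerivAt_toContinuousLinearMap γ.1 x).continuousAt).comp
          continuous_subtype_val))
    (eq_univ_of_forall fun x => by
      obtain ⟨γ, hγ, hx⟩ := horb x x.2.1
      exact mem_iUnion.2 ⟨⟨γ, hγ⟩, hx⟩)
  obtain ⟨O, hO, hqO⟩ := mem_nhds_subtype K q _ |>.1 (mem_interior_iff_mem_nhds.1 hq)
  obtain ⟨r, hr, hball⟩ := Metric.mem_nhds_iff.1 (inter_mem hO (hW.mem_nhds q.2.1))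
  have hhB : ContDiffOn ℝ 1 h (Metric.ball (q : E) r) := hh.mono fun x hx => (hball hx).2
  have hval : ∀ x ∈ Metric.ball (q : E) r, x ∉ locallyIn Γ h → h x = (γ : E ≃ᵃ[ℝ] E) x :=
    fun x hx hxV => hqO (show (⟨x, (hball hx).2, hxV⟩ : K) ∈ _ from (hball hx).1)
  have hqr : (q : E) ∈ Metric.ball (q : E) r := Metric.mem_ball_self hr
  have hEq := eqOn_of_jet_eq Metric.isOpen_ball (convex_ball _ _) hhB (Γ := Γ)
    (fun x hx hxV => ⟨hval x hx hxV, by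
      by_contra hne
      exact hxV (mem_locallyIn_of_fderiv_ne Metric.isOpen_ball hhB hval hx hne)⟩) hqr q.2.2
  exact q.2.2 ⟨γ, γ.2, hEq.eventuallyEq_of_mem (Metric.ball_mem_nhds _ hr)⟩

end OrbitRigidity

/-- Local rigidity: a C¹ orbit-preserving map on a (not necessarily connected) open set
agrees with an affine group element near each point. -/
theorem stmt1 (n : ℕ) (Γ : Subgroup ((Fin n → ℝ) ≃ᵃ[ℝ] (Fin n → ℝ)))
    (hΓ : Countable Γ) (W : Set (Fin n → ℝ)) (hWo : IsOpen W)
    (h : (Fin n → ℝ) → (Fin n → ℝ)) (hC1 : ContDiffOn ℝ 1 h W)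
    (horb : ∀ x ∈ W, ∃ γ ∈ Γ, h x = γ x) :
    ∀ x ∈ W, ∃ γ ∈ Γ, ∃ U : Set (Fin n → ℝ),
      IsOpen U ∧ x ∈ U ∧ U ⊆ W ∧ ∀ y ∈ U, h y = γ y := by
  intro x hx
  obtain ⟨γ, hγ, hxγ⟩ := subset_locallyIn_of_orbit hWo hC1 horb hx
  exact ⟨γ, hγ, W ∩ germSet h γ, hWo.inter (isOpen_germSet h γ), ⟨hx, hxγ⟩, inter_subset_left,
    fun y hy => EventuallyEq.eq_of_nhds hy.2⟩
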